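/- Let (K_j) be compact C¹ submanifolds of ℝⁿ converging in the C¹ sense to a compact C¹ submanifold K. Then limsup_j R_O(K_j) ≤ R_O(K), where R_O(L) = inf{r > 0 : there exist p ∈ L, a unit normal w to L at p, and q ∈ L with ‖(p + r·w) − q‖ < r}. -/

import Mathlib

open scoped RealInnerProductSpace

/-- `K` is a `k`-dimensional embedded `C¹` submanifold (without boundary) of `ℝⁿ`:
near each of its points, `K` is the image of an injective `C¹` immersion of an open
subset of `ℝᵏ`. -/
def IsC1Submanifold {n : ℕ} (k : ℕ) (K : Set (EuclideanSpace ℝ (Fin n))) : Prop :=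
  ∀ p ∈ K, ∃ (U : Set (EuclideanSpace ℝ (Fin k))) (V : Set (EuclideanSpace ℝ (Fin n)))
    (φ : EuclideanSpace ℝ (Fin k) → EuclideanSpace ℝ (Fin n)),
      IsOpen U ∧ IsOpen V ∧ p ∈ V ∧ ContDiffOn ℝ 1 φ U ∧ Set.InjOn φ U ∧
      φ '' U = K ∩ V ∧ ∀ x ∈ U, Function.Injective (fderiv ℝ φ x)

/-- `K` is a `k`-dimensional embedded `C^{1,1}` submanifold of `ℝⁿ`: a `C¹`
submanifold whose local parametrizations have locally Lipschitz derivative. -/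
def IsC11Submanifold {n : ℕ} (k : ℕ) (K : Set (EuclideanSpace ℝ (Fin n))) : Prop :=
  ∀ p ∈ K, ∃ (U : Set (EuclideanSpace ℝ (Fin k))) (V : Set (EuclideanSpace ℝ (Fin n)))
    (φ : EuclideanSpace ℝ (Fin k) → EuclideanSpace ℝ (Fin n)) (L : NNReal),
      IsOpen U ∧ IsOpen V ∧ p ∈ V ∧ ContDiffOn ℝ 1 φ U ∧ Set.InjOn φ U ∧
      φ '' U = K ∩ V ∧ (∀ x ∈ U, Function.Injective (fderiv ℝ φ x)) ∧
      LipschitzOnWith L (fderiv ℝ φ) U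

/-- `w` is a normal vector to `K` at `p`: it is orthogonal to the tangent cone of
`K` at `p`. -/
def IsNormalAt {n : ℕ} (K : Set (EuclideanSpace ℝ (Fin n))) (p w : EuclideanSpace ℝ (Fin n)) :
    Prop :=
  ∀ u ∈ tangentConeAt ℝ K p, ⟪u, w⟫ = 0

/-- The normal injectivity radius `i(K, ℝⁿ)` of `K ⊂ ℝⁿ`: the supremum of `0` and
all `r > 0` such that the normal exponential map `(p, v) ↦ p + v` is injective on
normal vectors of length `< r`. -/
noncomputable def normalInjRad {n : ℕ} (K : Set (EuclideanSpace ℝ (Fin n))) : ℝ :=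
  sSup ({0} ∪ {r : ℝ | 0 < r ∧
    Set.InjOn (fun pv : EuclideanSpace ℝ (Fin n) × EuclideanSpace ℝ (Fin n) => pv.1 + pv.2)
      {pv | pv.1 ∈ K ∧ IsNormalAt K pv.1 pv.2 ∧ ‖pv.2‖ < r}})

/-- The rolling-ball radius `R_O(K, ℝⁿ)`: the infimum of radii `r > 0` such that some
open ball of radius `r` tangent to `K` from a normal direction meets `K`. -/
noncomputable def ballRad {n : ℕ} (K : Set (EuclideanSpace ℝ (Fin n))) : ℝ :=
  sInf {r : ℝ | 0 < r ∧ ∃ p ∈ K, ∃ w : EuclideanSpace ℝ (Fin n),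
    IsNormalAt K p w ∧ ‖w‖ = 1 ∧ ∃ q ∈ K, dist (p + r • w) q < r}

/-- Distance between two linear subspaces (or cones) of `ℝⁿ`, measured as the
Hausdorff distance between their intersections with the unit sphere. -/
noncomputable def grassDist {n : ℕ} (S T : Set (EuclideanSpace ℝ (Fin n))) : ℝ :=
  Metric.hausdorffDist (S ∩ Metric.sphere (0 : EuclideanSpace ℝ (Fin n)) 1)
    (T ∩ Metric.sphere (0 : EuclideanSpace ℝ (Fin n)) 1)

open Filter Topology Set Asymptotics

/-- A vector against which the displacements of `K` from `p` are of smaller order is normal. -/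
theorem isNormalAt_of_isLittleO {n : ℕ} {K : Set (EuclideanSpace ℝ (Fin n))}
    {p w : EuclideanSpace ℝ (Fin n)}
    (h : (fun y => ⟪y - p, w⟫) =o[𝓝[K] p] (fun y => y - p)) : IsNormalAt K p w := by
  intro v hv
  obtain ⟨ι, l, hl, c, d, hd, hmem, hcd⟩ := exists_fun_of_mem_tangentConeAt hv
  have hlim : Tendsto (fun i => p + d i) l (𝓝[K] p) := by
    refine tendsto_nhdsWithin_iff.2 ⟨?_, hmem⟩
    simpa using tendsto_const_nhds.add hd
  have h1 : (fun i => ⟪d i, w⟫) =o[l] d := by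
    simpa [Function.comp_def] using h.comp_tendsto hlim
  have h2 : (fun i => ⟪c i • d i, w⟫) =o[l] (fun i => c i • d i) := by
    simpa [real_inner_smul_left] using (isBigO_refl c l).smul_isLittleO h1
  have h3 : Tendsto (fun i => ⟪c i • d i, w⟫) l (𝓝 0) :=
    (isLittleO_one_iff ℝ).1 (h2.trans_isBigO (hcd.isBigO_one ℝ))
  exact tendsto_nhds_unique (hcd.inner tendsto_const_nhds) h3

/-- An injective continuous map is open onto its image near each point of a compact set. -/
theorem IsCompact.nhdsWithin_image_le_map {X Y : Type*} [TopologicalSpace X] [TopologicalSpace Y]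
    [T2Space Y] {C : Set X} {φ : X → Y} (hC : IsCompact C) (hφ : ContinuousOn φ C)
    (hinj : InjOn φ C) {x : X} (hx : x ∈ C) : 𝓝[φ '' C] (φ x) ≤ map φ (𝓝 x) := by
  intro s hs
  have hcl : IsClosed (φ '' (C \ interior (φ ⁻¹' s))) :=
    ((hC.diff isOpen_interior).image_of_continuousOn (hφ.mono sdiff_subset)).isClosed
  have hnot : φ x ∉ φ '' (C \ interior (φ ⁻¹' s)) := by
    rintro ⟨y, ⟨hy, hys⟩, hxy⟩
    exact hys (hinj hy hx hxy ▸ mem_interior_iff_mem_nhds.2 hs)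
  filter_upwards [mem_nhdsWithin_of_mem_nhds (hcl.isOpen_compl.mem_nhds hnot),
    self_mem_nhdsWithin]
  rintro _ hy ⟨z, hz, rfl⟩
  by_contra hzs
  exact hy ⟨z, ⟨hz, fun h => hzs (interior_subset (s := φ ⁻¹' s) h)⟩, rfl⟩

/-- Near each point, a `C¹` submanifold contains the image of an immersion. -/
theorem IsC1Submanifold.exists_hasFDerivAt {n k : ℕ} {K : Set (EuclideanSpace ℝ (Fin n))}
    (hK : IsC1Submanifold k K) {p : EuclideanSpace ℝ (Fin n)} (hp : p ∈ K) :
    ∃ (φ : EuclideanSpace ℝ (Fin k) → EuclideanSpace ℝ (Fin n)) (x : EuclideanSpace ℝ (Fin k))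
      (D : EuclideanSpace ℝ (Fin k) →L[ℝ] EuclideanSpace ℝ (Fin n)),
      HasFDerivAt φ D x ∧ φ x = p ∧ (∀ᶠ y in 𝓝 x, φ y ∈ K) ∧ Function.Injective D := by
  obtain ⟨U, V, φ, hU, -, hpV, hφ, -, himg, hinj⟩ := hK p hp
  obtain ⟨x, hx, rfl⟩ : p ∈ φ '' U := himg ▸ ⟨hp, hpV⟩
  refine ⟨φ, x, fderiv ℝ φ x, ?_, rfl, ?_, hinj x hx⟩
  · exact ((hφ.differentiableOn one_ne_zero).differentiableAt (hU.mem_nhds hx)).hasFDerivAt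
  · filter_upwards [hU.mem_nhds hx] with y hy
    exact (himg ▸ mem_image_of_mem φ hy : φ y ∈ K ∩ V).1

/-- The image of the derivative of a parametrization consists of tangent vectors. -/
theorem HasFDerivAt.apply_mem_tangentConeAt {n k : ℕ} {K : Set (EuclideanSpace ℝ (Fin n))}
    {φ : EuclideanSpace ℝ (Fin k) → EuclideanSpace ℝ (Fin n)} {x : EuclideanSpace ℝ (Fin k)}
    {D : EuclideanSpace ℝ (Fin k) →L[ℝ] EuclideanSpace ℝ (Fin n)}
    (hD : HasFDerivAt φ D x) (hK : ∀ᶠ y in 𝓝 x, φ y ∈ K) (v : EuclideanSpace ℝ (Fin k)) :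
    D v ∈ tangentConeAt ℝ K (φ x) := by
  have hv : v ∈ tangentConeAt ℝ {y | φ y ∈ K} x := by
    rw [tangentConeAt_of_mem_nhds hK]; trivial
  have h := (hD.hasFDerivWithinAt (s := {y | φ y ∈ K})).mapsTo_tangent_cone hv
  exact tangentConeAt_mono (image_subset_iff.2 fun y hy => hy) h

/-- A compact `C¹` submanifold has, densely, points where every vector orthogonal to the image
of the derivative of a parametrization is normal. -/
theorem IsC1Submanifold.exists_mem_nhds_isNormalAt {n k : ℕ}
    {K : Set (EuclideanSpace ℝ (Fin n))} (hK : IsC1Submanifold k K) (hc : IsCompact K)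
    {p : EuclideanSpace ℝ (Fin n)} (hp : p ∈ K) {W : Set (EuclideanSpace ℝ (Fin n))}
    (hW : W ∈ 𝓝 p) :
    ∃ y ∈ K, y ∈ W ∧ ∃ D : EuclideanSpace ℝ (Fin k) →L[ℝ] EuclideanSpace ℝ (Fin n),
      Function.Injective D ∧ ∀ w, (∀ v, ⟪D v, w⟫ = 0) → IsNormalAt K y w := by
  obtain ⟨U, V, φ, hU, hV, hpV, hφ, hφinj, himg, hinj⟩ := hK p hp
  have : CompactSpace K := isCompact_iff_compactSpace.1 hc
  obtain ⟨C, hC, hCU⟩ : IsSigmaCompact U :=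
    have := hU.locallyCompactSpace
    isSigmaCompact_iff_sigmaCompactSpace.2 inferInstance
  have hCsub : ∀ i, C i ⊆ U := fun i => hCU ▸ subset_iUnion C i
  have himgC : ∀ i, IsCompact (φ '' C i) := fun i =>
    (hC i).image_of_continuousOn (hφ.continuousOn.mono (hCsub i))
  let f : Option ℕ → Set K := fun o =>
    o.elim (Subtype.val ⁻¹' Vᶜ) fun i => Subtype.val ⁻¹' (φ '' C i)
  have hf : ∀ o, IsClosed (f o) := by
    rintro (_ | i)
    · exact hV.isClosed_compl.preimage continuous_subtype_val
    · exact (himgC i).isClosed.preimage continuous_subtype_val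
  have hcov : ⋃ o, f o = univ := by
    refine eq_univ_of_forall fun z => mem_iUnion.2 ?_
    by_cases hz : (z : EuclideanSpace ℝ (Fin n)) ∈ V
    · obtain ⟨x, hx, hxz⟩ : (z : EuclideanSpace ℝ (Fin n)) ∈ φ '' U := himg ▸ ⟨z.2, hz⟩
      obtain ⟨i, hi⟩ := mem_iUnion.1 (hCU ▸ hx)
      exact ⟨some i, x, hi, hxz⟩
    · exact ⟨none, hz⟩
  obtain ⟨z, ⟨hzV, hzW⟩, hz⟩ := (dense_iUnion_interior_of_closed hf hcov).inter_open_nonempty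
    (Subtype.val ⁻¹' (V ∩ interior W)) ((hV.inter isOpen_interior).preimage continuous_subtype_val)
    ⟨⟨p, hp⟩, hpV, mem_interior_iff_mem_nhds.2 hW⟩
  obtain ⟨_ | i, hi⟩ := mem_iUnion.1 hz
  · exact absurd hzV (interior_subset hi)
  obtain ⟨x, hx, hxz⟩ : (z : EuclideanSpace ℝ (Fin n)) ∈ φ '' C i :=
    interior_subset (s := f (some i)) hi
  have hxU := hCsub i hx
  have hD : HasFDerivAt φ (fderiv ℝ φ x) x :=
    ((hφ.differentiableOn one_ne_zero).differentiableAt (hU.mem_nhds hxU)).hasFDerivAt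
  refine ⟨z, z.2, interior_subset hzW, fderiv ℝ φ x, hinj x hxU, fun w hw => ?_⟩
  refine isNormalAt_of_isLittleO ?_
  have hnhds : 𝓝[K] (z : EuclideanSpace ℝ (Fin n)) ≤ map φ (𝓝 x) := by
    refine le_trans ?_ ((hC i).nhdsWithin_image_le_map (hφ.continuousOn.mono (hCsub i))
      (hφinj.mono (hCsub i)) hx)
    rw [hxz]
    refine nhdsWithin_le_iff.2 ?_
    rw [nhdsWithin_eq_map_subtype_coe z.2]
    exact mem_interior_iff_mem_nhds.1 hi
  refine IsLittleO.mono ?_ hnhds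
  rw [isLittleO_map, ← hxz]
  obtain ⟨M, -, hM⟩ := (fderiv ℝ φ x).toLinearMap.exists_antilipschitzWith
    (LinearMap.ker_eq_bot.2 (hinj x hxU))
  have hrev : (fun y => y - x) =O[𝓝 x] fun y => φ y - φ x :=
    (hD.isTheta_sub (hM.isInducing (fderiv ℝ φ x).continuous)).2
  refine IsLittleO.trans_isBigO ?_ hrev
  have h1 := hD.isLittleO
  refine IsBigO.trans_isLittleO (IsBigO.of_bound ‖w‖ (Eventually.of_forall fun y => ?_)) h1
  have : ⟪φ y - φ x, w⟫ = ⟪φ y - φ x - fderiv ℝ φ x (y - x), w⟫ := by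
    rw [inner_sub_left _ (fderiv ℝ φ x (y - x)), hw, sub_zero]
  simp only [Function.comp_apply]
  rw [this, mul_comm]
  exact norm_inner_le_norm _ _

/-- Below the rolling-ball radius, open balls tangent to `K` do not meet `K`. -/
theorem two_mul_inner_le_of_lt_ballRad {n : ℕ} {K : Set (EuclideanSpace ℝ (Fin n))} {r : ℝ}
    (hr : 0 < r) (hK : r < ballRad K) {p q w : EuclideanSpace ℝ (Fin n)} (hp : p ∈ K)
    (hq : q ∈ K) (hw : IsNormalAt K p w) : 2 * r * ⟪w, q - p⟫ ≤ ‖w‖ * ‖q - p‖ ^ 2 := by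
  rcases eq_or_ne w 0 with rfl | hw0
  · simp
  have hpos : 0 < ‖w‖ := norm_pos_iff.2 hw0
  by_contra! hlt
  refine hK.not_ge (csInf_le ⟨0, fun s hs => hs.1.le⟩ ⟨hr, p, hp, ‖w‖⁻¹ • w, ?_, ?_, q, hq, ?_⟩)
  · intro u hu
    rw [real_inner_smul_right, hw u hu, mul_zero]
  · rw [norm_smul, norm_inv, norm_norm, inv_mul_cancel₀ hpos.ne']
  · rw [dist_eq_norm]
    refine lt_of_pow_lt_pow_left₀ 2 hr.le ?_
    have h1 : p + r • ‖w‖⁻¹ • w - q = (r * ‖w‖⁻¹) • w - (q - p) := by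
      rw [smul_smul]; abel
    rw [h1, norm_sub_sq_real, norm_smul, real_inner_smul_left, Real.norm_of_nonneg (by positivity),
      mul_assoc, inv_mul_cancel₀ hpos.ne']
    have h2 : ‖q - p‖ ^ 2 < 2 * (r * ‖w‖⁻¹ * ⟪w, q - p⟫) := by
      have : ‖q - p‖ ^ 2 = ‖w‖⁻¹ * (‖w‖ * ‖q - p‖ ^ 2) := by
        field_simp
      rw [this]
      have := mul_lt_mul_of_pos_left hlt (inv_pos.2 hpos)
      linarith
    linarith

/-- A vector on both sides of which tangent balls miss `K` is normal. -/
theorem isNormalAt_of_inner_le {n : ℕ} {K : Set (EuclideanSpace ℝ (Fin n))} {r : ℝ}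
    (hr : 0 < r) {p w : EuclideanSpace ℝ (Fin n)}
    (h : ∀ q ∈ K, 2 * r * ⟪w, q - p⟫ ≤ ‖w‖ * ‖q - p‖ ^ 2)
    (h' : ∀ q ∈ K, 2 * r * ⟪-w, q - p⟫ ≤ ‖w‖ * ‖q - p‖ ^ 2) : IsNormalAt K p w := by
  refine isNormalAt_of_isLittleO ?_
  have h1 : (fun q => ⟪q - p, w⟫) =O[𝓝[K] p] fun q => ‖q - p‖ ^ 2 := by
    refine IsBigO.of_bound (‖w‖ / (2 * r)) ?_
    filter_upwards [self_mem_nhdsWithin] with q hq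
    have h1 := h q hq
    have h2 := h' q hq
    rw [inner_neg_left] at h2
    rw [real_inner_comm, Real.norm_eq_abs, norm_pow, norm_norm, div_mul_eq_mul_div,
      le_div_iff₀ (by positivity), ← abs_of_pos (show 0 < 2 * r by positivity), ← abs_mul, abs_le]
    constructor <;> nlinarith
  refine h1.trans_isLittleO ?_
  have h2 : (fun q : EuclideanSpace ℝ (Fin n) => ‖q - p‖ ^ 2) =o[𝓝 p] fun q => q - p := by
    have := (isLittleO_norm_pow_id (E' := EuclideanSpace ℝ (Fin n)) one_lt_two).comp_tendsto
      (tendsto_sub_nhds_zero_iff.2 (tendsto_id (x := 𝓝 p)))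
    simpa [Function.comp_def] using this
  exact h2.mono nhdsWithin_le_nhds

/-- A compact `k`-dimensional submanifold with positive rolling-ball radius has `n - k` orthonormal
normal vectors at each point. -/
theorem IsC1Submanifold.exists_orthonormal_isNormalAt {n k : ℕ}
    {K : Set (EuclideanSpace ℝ (Fin n))} (hK : IsC1Submanifold k K) (hc : IsCompact K) {r : ℝ}
    (hr : 0 < r) (hball : r < ballRad K) {p : EuclideanSpace ℝ (Fin n)} (hp : p ∈ K) :
    ∃ f : Fin (n - k) → EuclideanSpace ℝ (Fin n), Orthonormal ℝ f ∧ ∀ a, IsNormalAt K p (f a) := by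
  let Z : Set (EuclideanSpace ℝ (Fin n) × (Fin (n - k) → EuclideanSpace ℝ (Fin n))) :=
    {z | (∀ a b, ⟪z.2 a, z.2 b⟫ = if a = b then (1 : ℝ) else 0) ∧ ∀ q ∈ K, ∀ a,
      2 * r * ⟪z.2 a, q - z.1⟫ ≤ ‖z.2 a‖ * ‖q - z.1‖ ^ 2 ∧
      2 * r * ⟪-z.2 a, q - z.1⟫ ≤ ‖z.2 a‖ * ‖q - z.1‖ ^ 2}
  have hZ : IsClosed Z := by
    simp only [Z, ofPred_and, ofPred_forall]
    refine IsClosed.inter ?_ ?_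
    · refine isClosed_iInter fun a => isClosed_iInter fun b => isClosed_eq (by fun_prop) (by fun_prop)
    · refine isClosed_iInter fun q => isClosed_iInter fun _ => isClosed_iInter fun a => ?_
      exact (isClosed_le (by fun_prop) (by fun_prop)).inter (isClosed_le (by fun_prop) (by fun_prop))
  have hcpt : IsCompact (Z ∩ K ×ˢ Metric.closedBall 0 1) :=
    (hc.prod (isCompact_closedBall _ _)).inter_left hZ
  have hdense : p ∈ closure (Prod.fst '' (Z ∩ K ×ˢ Metric.closedBall 0 1)) := by
    refine mem_closure_iff_nhds.2 fun W hW => ?_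
    obtain ⟨y, hyK, hyW, D, hD, hnormal⟩ := hK.exists_mem_nhds_isNormalAt hc hp hW
    have hfin : Module.finrank ℝ (LinearMap.range D.toLinearMap)ᗮ = n - k := by
      have h1 := Submodule.finrank_add_finrank_orthogonal (LinearMap.range D.toLinearMap)
      rw [LinearMap.finrank_range_of_inj hD, finrank_euclideanSpace_fin,
        finrank_euclideanSpace_fin] at h1
      omega
    let e := (stdOrthonormalBasis ℝ (LinearMap.range D.toLinearMap)ᗮ).reindex (finCongr hfin)
    let f : Fin (n - k) → EuclideanSpace ℝ (Fin n) := fun a => e a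
    have hf : Orthonormal ℝ f := e.orthonormal.comp_linearIsometry (Submodule.subtypeₗᵢ _)
    have hfn : ∀ a, IsNormalAt K y (f a) := fun a =>
      hnormal _ fun v => (e a).2 _ (LinearMap.mem_range_self D.toLinearMap v)
    refine ⟨y, hyW, (y, f), ⟨⟨orthonormal_iff_ite.1 hf, fun q hq a => ⟨?_, ?_⟩⟩, hyK, ?_⟩, rfl⟩
    · exact two_mul_inner_le_of_lt_ballRad hr hball hyK hq (hfn a)
    · rw [← norm_neg (f a)]
      refine two_mul_inner_le_of_lt_ballRad hr hball hyK hq fun u hu => ?_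
      rw [inner_neg_right, hfn a u hu, neg_zero]
    · rw [mem_closedBall_zero_iff, pi_norm_le_iff_of_nonneg zero_le_one]
      exact fun a => (hf.1 a).le
  rw [(hcpt.image continuous_fst).isClosed.closure_eq] at hdense
  obtain ⟨⟨_, f⟩, ⟨⟨hf, hineq⟩, -⟩, rfl⟩ := hdense
  exact ⟨f, orthonormal_iff_ite.2 hf, fun a =>
    isNormalAt_of_inner_le hr (fun q hq => (hineq q hq a).1) fun q hq => (hineq q hq a).2⟩

/-- Positivity of the rolling-ball radius bounds the dimension of the tangent cones. -/
theorem IsC1Submanifold.finrank_span_tangentConeAt_le {n k : ℕ}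
    {K : Set (EuclideanSpace ℝ (Fin n))} (hK : IsC1Submanifold k K) (hc : IsCompact K) {r : ℝ}
    (hr : 0 < r) (hball : r < ballRad K) {p : EuclideanSpace ℝ (Fin n)} (hp : p ∈ K) :
    Module.finrank ℝ (Submodule.span ℝ (tangentConeAt ℝ K p)) ≤ k := by
  obtain ⟨f, hf, hnormal⟩ := hK.exists_orthonormal_isNormalAt hc hr hball hp
  have hle : Submodule.span ℝ (tangentConeAt ℝ K p) ≤ (Submodule.span ℝ (range f))ᗮ := by
    rw [Submodule.le_orthogonal_iff_le_orthogonal, Submodule.span_le]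
    rintro _ ⟨a, rfl⟩
    refine (Submodule.mem_orthogonal _ _).2 fun u hu => ?_
    induction hu using Submodule.span_induction with
    | mem u hu => exact hnormal a u hu
    | zero => exact inner_zero_left _
    | add u v _ _ hu hv => rw [inner_add_left, hu, hv, add_zero]
    | smul c u _ hu => rw [real_inner_smul_left, hu, mul_zero]
  have h1 := Submodule.finrank_mono hle
  have h2 := Submodule.finrank_add_finrank_orthogonal (Submodule.span ℝ (range f))
  rw [finrank_span_eq_card hf.linearIndependent, Fintype.card_fin,
    finrank_euclideanSpace_fin] at h2
  omega

/-- If `A` is close to `B` and `B` has at most the dimension of `A`, then vectors orthogonal to `A`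
are almost orthogonal to `B`. -/
theorem Submodule.norm_starProjection_le_of_mem_orthogonal {E : Type*} [NormedAddCommGroup E]
    [InnerProductSpace ℝ E] [FiniteDimensional ℝ E] {A B : Submodule ℝ E}
    (hAB : Module.finrank ℝ B ≤ Module.finrank ℝ A) {ε : ℝ} (hε0 : 0 ≤ ε) (hε : ε ≤ 1 / 2)
    (h : ∀ a ∈ A, ∃ b ∈ B, ‖a - b‖ ≤ ε * ‖a‖) {w : E} (hw : w ∈ Aᗮ) :
    ‖B.starProjection w‖ ≤ 2 * ε * ‖w‖ := by
  have hproj : ∀ a ∈ A, ‖a - B.starProjection a‖ ≤ ε * ‖a‖ := by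
    intro a ha
    obtain ⟨b, hb, hab⟩ := h a ha
    rw [B.starProjection_minimal]
    exact (ciInf_le ⟨0, by rintro _ ⟨x, rfl⟩; exact norm_nonneg _⟩ (⟨b, hb⟩ : B)).trans hab
  let P : A →ₗ[ℝ] B := B.orthogonalProjectionOnto.toLinearMap ∘ₗ A.subtype
  have hP : ∀ a : A, (P a : E) = B.starProjection a := fun a => rfl
  have hinj : Function.Injective P := by
    rw [injective_iff_map_eq_zero]
    intro a ha
    have h1 := hproj a a.2
    rw [← hP, ha, ZeroMemClass.coe_zero, sub_zero] at h1
    have h2 : ‖(a : E)‖ ≤ 0 := by nlinarith [norm_nonneg (a : E)]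
    exact Subtype.ext (norm_le_zero_iff.1 h2)
  have hsurj : Function.Surjective P :=
    (LinearMap.injective_iff_surjective_of_finrank_eq_finrank
      ((LinearMap.finrank_le_finrank_of_injective hinj).antisymm hAB)).1 hinj
  obtain ⟨a, ha⟩ := hsurj (B.orthogonalProjectionOnto w)
  have ha' : B.starProjection (a : E) = B.starProjection w := congrArg Subtype.val ha
  set b := B.starProjection w with hb
  have h1 := hproj a a.2
  rw [ha'] at h1
  have h2 : ‖(a : E)‖ ≤ 2 * ‖b‖ := by
    have := norm_sub_norm_le (a : E) b
    nlinarith [norm_nonneg (a : E)]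
  have hsq : ‖b‖ ^ 2 = ⟪b - a, w⟫ := by
    have h3 : ⟪b, w - b⟫ = 0 :=
      Submodule.inner_right_of_mem_orthogonal (B.starProjection_apply_mem w)
        (B.sub_starProjection_mem_orthogonal w)
    rw [inner_sub_right, real_inner_self_eq_norm_sq] at h3
    rw [inner_sub_left, Submodule.inner_right_of_mem_orthogonal a.2 hw]
    linarith
  have hle : ‖b‖ ^ 2 ≤ 2 * ε * ‖w‖ * ‖b‖ := by
    calc ‖b‖ ^ 2 ≤ ‖b - a‖ * ‖w‖ := hsq ▸ real_inner_le_norm _ _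
      _ ≤ (ε * (2 * ‖b‖)) * ‖w‖ := by
        rw [norm_sub_rev]
        gcongr
        exact h1.trans (by gcongr)
      _ = 2 * ε * ‖w‖ * ‖b‖ := by ring
  rcases (norm_nonneg b).eq_or_lt with h0 | h0
  · rw [← h0]; positivity
  · rw [sq] at hle
    exact le_of_mul_le_mul_right hle h0

theorem grassDist_nonneg {n : ℕ} (S T : Set (EuclideanSpace ℝ (Fin n))) : 0 ≤ grassDist S T :=
  Metric.hausdorffDist_nonneg

/-- Vectors normal to `K` are close to vectors normal to a set whose tangent cone is close to that
of `K` and has dimension at most `k`. -/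
theorem exists_isNormalAt_norm_sub_le {n k : ℕ} {K L : Set (EuclideanSpace ℝ (Fin n))}
    {p q : EuclideanSpace ℝ (Fin n)}
    {D D' : EuclideanSpace ℝ (Fin k) →L[ℝ] EuclideanSpace ℝ (Fin n)}
    (hD : Function.Injective D) (hDK : ∀ v, D v ∈ tangentConeAt ℝ K p)
    (hD' : Function.Injective D') (hDL : ∀ v, D' v ∈ tangentConeAt ℝ L q)
    (hdim : Module.finrank ℝ (Submodule.span ℝ (tangentConeAt ℝ L q)) ≤ k) {ε : ℝ}
    (hε : ε ≤ 1 / 2) (hdist : grassDist (tangentConeAt ℝ K p) (tangentConeAt ℝ L q) < ε)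
    {w : EuclideanSpace ℝ (Fin n)} (hw : ∀ v, ⟪D v, w⟫ = 0) :
    ∃ w', IsNormalAt L q w' ∧ ‖w' - w‖ ≤ 2 * ε * ‖w‖ := by
  have hε0 : 0 ≤ ε := (grassDist_nonneg _ _).trans hdist.le
  have hunit : ∀ {F : EuclideanSpace ℝ (Fin k) →L[ℝ] EuclideanSpace ℝ (Fin n)}
      {S : Set (EuclideanSpace ℝ (Fin n))}, (∀ v, F v ∈ S) → ∀ v, F v ≠ 0 →
      ‖F v‖⁻¹ • F v ∈ S ∩ Metric.sphere 0 1 := by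
    intro F S hF v hv
    refine ⟨by rw [← map_smul]; exact hF _, ?_⟩
    rw [mem_sphere_zero_iff_norm, norm_smul, norm_inv, norm_norm,
      inv_mul_cancel₀ (norm_ne_zero_iff.2 hv)]
  set B := Submodule.span ℝ (tangentConeAt ℝ L q)
  have hclose : ∀ a ∈ LinearMap.range D.toLinearMap, ∃ b ∈ B, ‖a - b‖ ≤ ε * ‖a‖ := by
    rintro _ ⟨v, rfl⟩
    change ∃ b ∈ B, ‖D v - b‖ ≤ ε * ‖D v‖
    rcases eq_or_ne (D v) 0 with h0 | h0
    · exact ⟨0, B.zero_mem, by simp [h0]⟩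
    have h0' : D' v ≠ 0 := by
      rw [← map_zero D', hD'.ne_iff]
      rintro rfl
      exact h0 (map_zero D)
    have hfin : Metric.hausdorffEDist (tangentConeAt ℝ K p ∩ Metric.sphere 0 1)
        (tangentConeAt ℝ L q ∩ Metric.sphere 0 1) ≠ ⊤ :=
      Metric.hausdorffEDist_ne_top_of_nonempty_of_bounded ⟨_, hunit hDK v h0⟩ ⟨_, hunit hDL v h0'⟩
        (Metric.isBounded_sphere.subset inter_subset_right)
        (Metric.isBounded_sphere.subset inter_subset_right)
    obtain ⟨y, ⟨hy, -⟩, hdy⟩ := Metric.exists_dist_lt_of_hausdorffDist_lt (hunit hDK v h0) hdist hfin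
    refine ⟨‖D v‖ • y, B.smul_mem _ (Submodule.subset_span hy), ?_⟩
    have h1 : D v - ‖D v‖ • y = ‖D v‖ • (‖D v‖⁻¹ • D v - y) := by
      rw [smul_sub, smul_inv_smul₀ (norm_ne_zero_iff.2 h0)]
    rw [h1, norm_smul, norm_norm, mul_comm, ← dist_eq_norm]
    gcongr
  refine ⟨w - B.starProjection w, fun u hu => ?_, ?_⟩
  · exact Submodule.inner_right_of_mem_orthogonal (Submodule.subset_span hu)
      (B.sub_starProjection_mem_orthogonal w)
  · rw [sub_sub_cancel_left, norm_neg]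
    refine Submodule.norm_starProjection_le_of_mem_orthogonal ?_ hε0 hε hclose ?_
    · rwa [LinearMap.finrank_range_of_inj hD, finrank_euclideanSpace_fin]
    · refine (Submodule.mem_orthogonal _ _).2 ?_
      rintro _ ⟨v, rfl⟩
      exact hw v

/-- The tangent ball condition at radius `r` passes to `C¹` limits. -/
theorem two_mul_inner_le_of_frequently_lt_ballRad {n k : ℕ}
    {Kseq : ℕ → Set (EuclideanSpace ℝ (Fin n))} {K : Set (EuclideanSpace ℝ (Fin n))}
    (hKseq : ∀ j, IsC1Submanifold k (Kseq j)) (hcseq : ∀ j, IsCompact (Kseq j))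
    {ψ : ℕ → EuclideanSpace ℝ (Fin n) → EuclideanSpace ℝ (Fin n)}
    (hmaps : ∀ j, MapsTo (ψ j) K (Kseq j))
    (hconv : ∀ ε > (0 : ℝ), ∃ N : ℕ, ∀ j ≥ N, ∀ x ∈ K,
      dist x (ψ j x) +
        grassDist (tangentConeAt ℝ K x) (tangentConeAt ℝ (Kseq j) (ψ j x)) < ε)
    {r : ℝ} (hr : 0 < r) (hfreq : ∃ᶠ j in atTop, r < ballRad (Kseq j))
    {p q : EuclideanSpace ℝ (Fin n)} (hp : p ∈ K) (hq : q ∈ K)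
    {D : EuclideanSpace ℝ (Fin k) →L[ℝ] EuclideanSpace ℝ (Fin n)} (hD : Function.Injective D)
    (hDK : ∀ v, D v ∈ tangentConeAt ℝ K p) {w : EuclideanSpace ℝ (Fin n)}
    (hw : ∀ v, ⟪D v, w⟫ = 0) : 2 * r * ⟪w, q - p⟫ ≤ ‖w‖ * ‖q - p‖ ^ 2 := by
  have happrox : ∀ m : ℕ, ∃ p' q' w' : EuclideanSpace ℝ (Fin n),
      dist p' p ≤ 1 / ((m : ℝ) + 1) ∧ dist q' q ≤ 1 / ((m : ℝ) + 1) ∧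
      dist w' w ≤ 2 * (1 / ((m : ℝ) + 1)) * ‖w‖ ∧
      2 * r * ⟪w', q' - p'⟫ ≤ ‖w'‖ * ‖q' - p'‖ ^ 2 := by
    intro m
    have hm : (0 : ℝ) < 1 / ((m : ℝ) + 1) := by positivity
    obtain ⟨N, hN⟩ := hconv (min (1 / ((m : ℝ) + 1)) (1 / 2)) (lt_min hm one_half_pos)
    obtain ⟨j, hjN, hj⟩ := frequently_atTop.1 hfreq N
    have hdist : ∀ x ∈ K, dist (ψ j x) x ≤ 1 / ((m : ℝ) + 1) := fun x hx => by
      rw [dist_comm]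
      linarith [grassDist_nonneg (tangentConeAt ℝ K x) (tangentConeAt ℝ (Kseq j) (ψ j x)),
        hN j hjN x hx, min_le_left (1 / ((m : ℝ) + 1)) (1 / 2)]
    obtain ⟨φ, x, D', hφ, hx, hφK, hD'⟩ := (hKseq j).exists_hasFDerivAt (hmaps j hp)
    obtain ⟨w', hw'n, hw'⟩ := exists_isNormalAt_norm_sub_le hD hDK hD'
      (fun v => hx ▸ hφ.apply_mem_tangentConeAt hφK v)
      ((hKseq j).finrank_span_tangentConeAt_le (hcseq j) hr hj (hmaps j hp))
      (min_le_right (1 / ((m : ℝ) + 1)) (1 / 2))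
      (by linarith [hN j hjN p hp, dist_nonneg (x := p) (y := ψ j p)]) hw
    refine ⟨ψ j p, ψ j q, w', hdist p hp, hdist q hq, ?_,
      two_mul_inner_le_of_lt_ballRad hr hj (hmaps j hp) (hmaps j hq) hw'n⟩
    rw [dist_eq_norm]
    refine hw'.trans ?_
    gcongr
    exact min_le_left _ _
  choose p' q' w' hp' hq' hw' hineq using happrox
  have h0 : Tendsto (fun m : ℕ => 1 / ((m : ℝ) + 1)) atTop (𝓝 0) :=
    tendsto_one_div_add_atTop_nhds_zero_nat
  have hpl : Tendsto p' atTop (𝓝 p) := tendsto_iff_dist_tendsto_zero.2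
    (squeeze_zero (fun _ => dist_nonneg) hp' h0)
  have hql : Tendsto q' atTop (𝓝 q) := tendsto_iff_dist_tendsto_zero.2
    (squeeze_zero (fun _ => dist_nonneg) hq' h0)
  have hwl : Tendsto w' atTop (𝓝 w) := tendsto_iff_dist_tendsto_zero.2
    (squeeze_zero (fun _ => dist_nonneg) hw'
      (by simpa using (h0.const_mul 2).mul_const ‖w‖))
  exact le_of_tendsto_of_tendsto' ((hwl.inner (hql.sub hpl)).const_mul (2 * r))
    (hwl.norm.mul ((hql.sub hpl).norm.pow 2)) hineq

theorem ballRad_nonneg {n : ℕ} (K : Set (EuclideanSpace ℝ (Fin n))) : 0 ≤ ballRad K :=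
  Real.sInf_nonneg fun _ hr => hr.1.le

theorem ballRad_of_subsingleton {n : ℕ} {K : Set (EuclideanSpace ℝ (Fin n))}
    (hK : K.Subsingleton) : ballRad K = 0 := by
  unfold ballRad
  convert Real.sInf_empty
  refine eq_empty_of_forall_notMem ?_
  rintro r ⟨hr, p, hp, w, -, hw, q, hq, hdist⟩
  rw [hK hq hp, dist_self_add_left, norm_smul, hw, mul_one, Real.norm_of_nonneg hr.le] at hdist
  exact hdist.false

/-- A normal vector at `p` with positive component towards a point of `K` spans tangent balls that
meet `K`. -/
theorem exists_dist_lt_of_inner_pos {n : ℕ} {K : Set (EuclideanSpace ℝ (Fin n))}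
    {p q w : EuclideanSpace ℝ (Fin n)} (hp : p ∈ K) (hq : q ∈ K) (hw : IsNormalAt K p w)
    (hpos : 0 < ⟪w, q - p⟫) :
    ∃ r : ℝ, 0 < r ∧ ∃ p ∈ K, ∃ w : EuclideanSpace ℝ (Fin n),
      IsNormalAt K p w ∧ ‖w‖ = 1 ∧ ∃ q ∈ K, dist (p + r • w) q < r := by
  have hw0 : w ≠ 0 := by rintro rfl; simp at hpos
  have hwn : 0 < ‖w‖ := norm_pos_iff.2 hw0
  have hqp : q - p ≠ 0 := fun h => by simp [h] at hpos
  have hqpn : 0 < ‖q - p‖ := norm_pos_iff.2 hqp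
  set s := ⟪‖w‖⁻¹ • w, q - p⟫ with hs
  have hspos : 0 < s := by rw [hs, real_inner_smul_left]; positivity
  have hnorm : ‖‖w‖⁻¹ • w‖ = 1 := by
    rw [norm_smul, norm_inv, norm_norm, inv_mul_cancel₀ hwn.ne']
  have hr : 0 < ‖q - p‖ ^ 2 / s := by positivity
  refine ⟨‖q - p‖ ^ 2 / s, hr, p, hp, ‖w‖⁻¹ • w, ?_, hnorm, q, hq, ?_⟩
  · intro u hu
    rw [real_inner_smul_right, hw u hu, mul_zero]
  · rw [dist_eq_norm]
    refine lt_of_pow_lt_pow_left₀ 2 hr.le ?_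
    rw [show p + (‖q - p‖ ^ 2 / s) • ‖w‖⁻¹ • w - q = (‖q - p‖ ^ 2 / s) • ‖w‖⁻¹ • w - (q - p) by abel,
      norm_sub_sq_real, norm_smul, hnorm, real_inner_smul_left, ← hs, div_mul_cancel₀ _ hspos.ne',
      mul_one, Real.norm_of_nonneg hr.le]
    nlinarith [pow_pos hqpn 2]

/-- At a maximum of a linear functional, the derivative of a parametrization is orthogonal to it. -/
theorem HasFDerivAt.inner_apply_eq_zero_of_isMaxOn {n k : ℕ} {K : Set (EuclideanSpace ℝ (Fin n))}
    {φ : EuclideanSpace ℝ (Fin k) → EuclideanSpace ℝ (Fin n)} {x : EuclideanSpace ℝ (Fin k)}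
    {D : EuclideanSpace ℝ (Fin k) →L[ℝ] EuclideanSpace ℝ (Fin n)}
    (hD : HasFDerivAt φ D x) (hK : ∀ᶠ y in 𝓝 x, φ y ∈ K) {u : EuclideanSpace ℝ (Fin n)}
    (hmax : IsMaxOn (fun y => ⟪u, y⟫) K (φ x)) (v : EuclideanSpace ℝ (Fin k)) : ⟪D v, u⟫ = 0 := by
  have hloc : IsLocalMax (fun y => ⟪u, φ y⟫) x := hK.mono fun y hy => hmax hy
  have h := hloc.hasFDerivAt_eq_zero ((innerSL ℝ u).hasFDerivAt.comp x hD)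
  rw [real_inner_comm]
  exact DFunLike.congr_fun h v

/-- **Proposition 2 (Euclidean case): upper semicontinuity of the rolling-ball radius
under `C¹` convergence.** If compact `C¹` submanifolds `K_j` converge to a compact
`C¹` submanifold `K` in the `C¹` sense — via bijections `ψ_j : K → K_j` with
`sup_{x ∈ K} (dist x (ψ_j x) + d_Gr(T_x K, T_{ψ_j x} K_j)) → 0` — then
`limsup_j R_O(K_j) ≤ R_O(K)`. -/
theorem limsup_ballRad_le {n k : ℕ}
    (Kseq : ℕ → Set (EuclideanSpace ℝ (Fin n))) (K : Set (EuclideanSpace ℝ (Fin n)))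
    (hKseq : ∀ j, IsC1Submanifold k (Kseq j)) (hcseq : ∀ j, IsCompact (Kseq j))
    (hK : IsC1Submanifold k K) (hcomp : IsCompact K) (hne : K.Nonempty)
    (ψ : ℕ → EuclideanSpace ℝ (Fin n) → EuclideanSpace ℝ (Fin n))
    (hbij : ∀ j, Set.BijOn (ψ j) K (Kseq j))
    (hconv : ∀ ε > (0 : ℝ), ∃ N : ℕ, ∀ j ≥ N, ∀ x ∈ K,
      dist x (ψ j x) +
        grassDist (tangentConeAt ℝ K x) (tangentConeAt ℝ (Kseq j) (ψ j x)) < ε) :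
    Filter.limsup (fun j => ballRad (Kseq j)) Filter.atTop ≤ ballRad K := by
  by_contra! hlt
  have hcob : IsCoboundedUnder (· ≤ ·) atTop fun j => ballRad (Kseq j) :=
    (isBoundedUnder_of ⟨0, fun j => ballRad_nonneg (Kseq j)⟩ :
      IsBoundedUnder (· ≥ ·) atTop fun j => ballRad (Kseq j)).isCoboundedUnder_le
  have hmaps : ∀ j, MapsTo (ψ j) K (Kseq j) := fun j => (hbij j).mapsTo
  have hne' : ∃ r : ℝ, 0 < r ∧ ∃ p ∈ K, ∃ w : EuclideanSpace ℝ (Fin n),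
      IsNormalAt K p w ∧ ‖w‖ = 1 ∧ ∃ q ∈ K, dist (p + r • w) q < r := by
    obtain ⟨r, hr, hr'⟩ := exists_between hlt
    have hr0 : 0 < r := (ballRad_nonneg K).trans_lt hr
    have hfreq := frequently_lt_of_lt_limsup hcob hr'
    have hnt : K.Nontrivial := by
      rw [← not_subsingleton_iff]
      intro hsub
      obtain ⟨j, hj⟩ := hfreq.exists
      rw [ballRad_of_subsingleton ((hbij j).image_eq ▸ hsub.image _)] at hj
      exact hr0.not_gt hj
    obtain ⟨a, ha, b, hb, hab⟩ := hnt
    obtain ⟨p, hp, hmax⟩ := hcomp.exists_isMaxOn hne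
      (f := fun y => ⟪b - a, y⟫) (by fun_prop)
    obtain ⟨φ, x, D, hφ, rfl, hφK, hD⟩ := hK.exists_hasFDerivAt hp
    have hu := hφ.inner_apply_eq_zero_of_isMaxOn hφK hmax
    have hineq : ∀ w, (∀ v, ⟪D v, w⟫ = 0) → ∀ q ∈ K,
        2 * r * ⟪w, q - φ x⟫ ≤ ‖w‖ * ‖q - φ x‖ ^ 2 := fun w hw q hq =>
      two_mul_inner_le_of_frequently_lt_ballRad hKseq hcseq hmaps hconv hr0 hfreq hp hq hD
        (hφ.apply_mem_tangentConeAt hφK) hw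
    have hnormal : IsNormalAt K (φ x) (-(b - a)) := by
      have hu' : ∀ v, ⟪D v, -(b - a)⟫ = 0 := fun v => by rw [inner_neg_right, hu, neg_zero]
      refine isNormalAt_of_inner_le hr0 (hineq _ hu') ?_
      rw [neg_neg, norm_neg]
      exact hineq _ hu
    refine exists_dist_lt_of_inner_pos hp ha hnormal ?_
    have h1 : ⟪b - a, b⟫ ≤ ⟪b - a, φ x⟫ := hmax hb
    have h2 : 0 < ⟪b - a, b - a⟫ := real_inner_self_pos.2 (sub_ne_zero.2 hab.symm)
    rw [inner_sub_right] at h2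
    rw [inner_neg_left, inner_sub_right]
    linarith
  obtain ⟨r, ⟨hr0, p, hp, w, hw, hw1, q, hq, hdist⟩, hr⟩ := exists_lt_of_csInf_lt hne' hlt
  obtain ⟨φ, x, D, hφ, rfl, hφK, hD⟩ := hK.exists_hasFDerivAt hp
  have hDK := hφ.apply_mem_tangentConeAt hφK
  have h := two_mul_inner_le_of_frequently_lt_ballRad hKseq hcseq hmaps hconv hr0
    (frequently_lt_of_lt_limsup hcob hr) hp hq hD hDK fun v => hw _ (hDK v)
  rw [dist_eq_norm, show φ x + r • w - q = r • w - (q - φ x) by abel] at hdist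
  have h2 := pow_lt_pow_left₀ hdist (norm_nonneg _) two_ne_zero
  rw [norm_sub_sq_real, norm_smul, hw1, real_inner_smul_left, mul_one,
    Real.norm_of_nonneg hr0.le] at h2
  rw [hw1, one_mul] at h
  linarith
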